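/- Let φ ∈ C(T_2)^+ with φ not identically zero. Then for every integer k ≥ 3 there exists a constant b_k > 0 such that (B^k φ)(θ) ≥ b_k for every θ ∈ T_2. Consequently, B is a u_0-positive operator on C(T_2, ℝ) with respect to the cone C(T_2)^+, where u_0 is the constant function 1. -/

import Mathlib

open MeasureTheory

noncomputable section

/-- The average integral `⨏_a^b f`, with the convention `⨏_a^a f = f a`. -/
def avg (a b : ℝ) (f : ℝ → ℝ) : ℝ :=
  if a = b then f a else (b - a)⁻¹ * ∫ x in a..b, f x

/-- The simplex `T₂ = {θ ∈ [-1,0]² : θ₁ ≤ θ₂}`. -/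
def T2set : Set (ℝ × ℝ) :=
  {p | -1 ≤ p.1 ∧ p.1 ≤ p.2 ∧ p.2 ≤ 0}

/-- The operator `B = B₀ + B₁`, where `(B₀φ)(θ₁,θ₂) = -⨏_{θ₁}^{θ₂} t φ(t,0) dt` and
`(B₁φ)(θ₁,θ₂) = ∫_{-1}^{θ₁} ⨏_{θ₁}^{θ₂} (t₁-t₀) φ(t₀,t₁) dt₁ dt₀`. -/
def B2op (φ : ℝ × ℝ → ℝ) (p : ℝ × ℝ) : ℝ :=
  -(avg p.1 p.2 fun t => t * φ (t, 0)) +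
    ∫ t₀ in (-1 : ℝ)..p.1, avg p.1 p.2 fun t₁ => (t₁ - t₀) * φ (t₀, t₁)

def prj (p : ℝ × ℝ) : ℝ × ℝ :=
  (max (-1) (min p.1 0), max (max (-1) (min p.1 0)) (min p.2 0))

lemma prj_cont : Continuous prj := by unfold prj; fun_prop

lemma prj_mem (p : ℝ × ℝ) : prj p ∈ T2set := by
  simp [prj, T2set]

lemma prj_eq {p : ℝ × ℝ} (hp : p ∈ T2set) : prj p = p := by
  obtain ⟨h1, h2, h3⟩ := hp
  obtain ⟨x, y⟩ := p
  simp only at h1 h2 h3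
  simp only [prj, Prod.mk.injEq]
  rw [min_eq_left (h2.trans h3), min_eq_left h3, max_eq_right h1, max_eq_right h2]
  exact ⟨rfl, rfl⟩

lemma avg_eq (a b : ℝ) (f : ℝ → ℝ) : avg a b f = ∫ s in (0 : ℝ)..1, f (a + (b - a) * s) := by
  unfold avg
  split_ifs with h
  · subst h; simp
  · rw [intervalIntegral.integral_comp_add_mul _ (sub_ne_zero.2 (Ne.symm h))]
    simp

def G0 (ψ : ℝ × ℝ → ℝ) (p : ℝ × ℝ) : ℝ :=
  ∫ s in (0 : ℝ)..1, -(p.1 + (p.2 - p.1) * s) * ψ (p.1 + (p.2 - p.1) * s, 0)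

def G1in (ψ : ℝ × ℝ → ℝ) (p : ℝ × ℝ) (t : ℝ) : ℝ :=
  ∫ s in (0 : ℝ)..1, (p.1 + (p.2 - p.1) * s - t) * ψ (t, p.1 + (p.2 - p.1) * s)

def G1 (ψ : ℝ × ℝ → ℝ) (p : ℝ × ℝ) : ℝ := ∫ t in (-1 : ℝ)..p.1, G1in ψ p t

lemma seg_mem {p : ℝ × ℝ} (hp : p ∈ T2set) {s : ℝ} (h0 : 0 ≤ s) (h1 : s ≤ 1) :
    p.1 ≤ p.1 + (p.2 - p.1) * s ∧ p.1 + (p.2 - p.1) * s ≤ p.2 := by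
  obtain ⟨_, h2, _⟩ := hp
  constructor <;> nlinarith

lemma seg_surj {p : ℝ × ℝ} {t : ℝ} (h1 : p.1 ≤ t) (h2 : t ≤ p.2) :
    ∃ s ∈ Set.Icc (0 : ℝ) 1, p.1 + (p.2 - p.1) * s = t := by
  rcases eq_or_lt_of_le (h1.trans h2) with h | h
  · exact ⟨0, by simp, by linarith⟩
  · have : 0 < p.2 - p.1 := by linarith
    refine ⟨(t - p.1) / (p.2 - p.1), ⟨by apply div_nonneg <;> linarith, ?_⟩, by field_simp; ring⟩
    rw [div_le_one this]; linarith

lemma B2op_eq (φ : ℝ × ℝ → ℝ) {p : ℝ × ℝ} (hp : p ∈ T2set) :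
    B2op φ p = G0 (φ ∘ prj) p + G1 (φ ∘ prj) p := by
  unfold B2op G0 G1
  have hp' := hp
  obtain ⟨h1, h2, h3⟩ := hp
  congr 1
  · rw [avg_eq, ← intervalIntegral.integral_neg]
    apply intervalIntegral.integral_congr
    intro s hs
    rw [Set.uIcc_of_le zero_le_one] at hs
    have := seg_mem hp' hs.1 hs.2
    simp only [Function.comp]
    rw [prj_eq]
    · ring
    · exact ⟨by simp only; linarith, by simp only; linarith, le_rfl⟩
  · apply intervalIntegral.integral_congr
    intro t ht
    rw [Set.uIcc_of_le h1] at ht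
    simp only [G1in]
    rw [avg_eq]
    apply intervalIntegral.integral_congr
    intro s hs
    rw [Set.uIcc_of_le zero_le_one] at hs
    have := seg_mem hp' hs.1 hs.2
    simp only [Function.comp]
    rw [prj_eq]
    exact ⟨ht.1, by simp only; linarith [ht.2], by simp only; linarith⟩

lemma G0_cont {ψ : ℝ × ℝ → ℝ} (h : Continuous ψ) : Continuous (G0 ψ) := by
  unfold G0
  apply intervalIntegral.continuous_parametric_intervalIntegral_of_continuous' 
  simp only [Function.uncurry_def]
  fun_prop

lemma G1in_cont {ψ : ℝ × ℝ → ℝ} (h : Continuous ψ) :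
    Continuous (Function.uncurry (G1in ψ)) := by
  unfold G1in
  simp only [Function.uncurry_def]
  apply intervalIntegral.continuous_parametric_intervalIntegral_of_continuous' 
  simp only [Function.uncurry_def]
  fun_prop

lemma G1_cont {ψ : ℝ × ℝ → ℝ} (h : Continuous ψ) : Continuous (G1 ψ) := by
  unfold G1
  exact intervalIntegral.continuous_parametric_intervalIntegral_of_continuous
    (G1in_cont h) continuous_fst

section
variable {ψ : ℝ × ℝ → ℝ} (h : Continuous ψ) (hn : ∀ p, 0 ≤ ψ p) {p : ℝ × ℝ} (hp : p ∈ T2set)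

lemma G0_nonneg (hn : ∀ p, 0 ≤ ψ p) (hp : p ∈ T2set) : 0 ≤ G0 ψ p := by
  apply intervalIntegral.integral_nonneg zero_le_one
  intro s hs
  have := seg_mem hp hs.1 hs.2
  exact mul_nonneg (by linarith [hp.2.2]) (hn _)

lemma G1in_nonneg (hn : ∀ p, 0 ≤ ψ p) (hp : p ∈ T2set) {t : ℝ} (ht : t ≤ p.1) :
    0 ≤ G1in ψ p t := by
  apply intervalIntegral.integral_nonneg zero_le_one
  intro s hs
  have := seg_mem hp hs.1 hs.2
  exact mul_nonneg (by linarith) (hn _)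

lemma G1_nonneg (hn : ∀ p, 0 ≤ ψ p) (hp : p ∈ T2set) : 0 ≤ G1 ψ p := by
  apply intervalIntegral.integral_nonneg hp.1
  intro s hs
  exact G1in_nonneg hn hp hs.2

lemma G0_pos (h : Continuous ψ) (hn : ∀ p, 0 ≤ ψ p) (hp : p ∈ T2set) {t : ℝ} (h1 : p.1 ≤ t)
    (h2 : t ≤ p.2) (ht : t < 0) (hpos : 0 < ψ (t, 0)) : 0 < G0 ψ p := by
  apply intervalIntegral.integral_pos zero_lt_one
  · apply Continuous.continuousOn; fun_prop
  · intro s hs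
    have := seg_mem hp hs.1.le hs.2
    exact mul_nonneg (by linarith [hp.2.2]) (hn _)
  · obtain ⟨s, hs, he⟩ := seg_surj h1 h2
    refine ⟨s, hs, ?_⟩
    rw [he]
    exact mul_pos (by linarith) hpos

lemma G1_pos (h : Continuous ψ) (hn : ∀ p, 0 ≤ ψ p) (hp : p ∈ T2set) (hp1 : -1 < p.1)
    {t₀ t : ℝ} (h0 : -1 ≤ t₀) (h0' : t₀ ≤ p.1) (h1 : p.1 ≤ t)
    (h2 : t ≤ p.2) (ht : t₀ < t) (hpos : 0 < ψ (t₀, t)) : 0 < G1 ψ p := by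
  apply intervalIntegral.integral_pos hp1
  · have := G1in_cont h
    exact (this.comp (Continuous.prodMk_right p)).continuousOn
  · intro s hs
    exact G1in_nonneg hn hp hs.2
  · refine ⟨t₀, ⟨h0, h0'⟩, ?_⟩
    apply intervalIntegral.integral_pos zero_lt_one
    · apply Continuous.continuousOn; fun_prop
    · intro s hs
      have := seg_mem hp hs.1.le hs.2
      exact mul_nonneg (by linarith) (hn _)
    · obtain ⟨s, hs, he⟩ := seg_surj h1 h2
      refine ⟨s, hs, ?_⟩
      rw [he]
      exact mul_pos (by linarith) hpos
end

def Good (φ : ℝ × ℝ → ℝ) : Prop := ContinuousOn φ T2set ∧ ∀ p ∈ T2set, 0 ≤ φ p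

section
variable {φ : ℝ × ℝ → ℝ}

lemma Good.cont (h : Good φ) : Continuous (φ ∘ prj) :=
  h.1.comp_continuous prj_cont prj_mem

lemma Good.nn (h : Good φ) : ∀ p, 0 ≤ (φ ∘ prj) p := fun p => h.2 _ (prj_mem p)

lemma Good.step (h : Good φ) : Good (B2op φ) := by
  constructor
  · exact ((G0_cont h.cont).add (G1_cont h.cont)).continuousOn.congr fun p hp => B2op_eq φ hp
  · intro p hp
    rw [B2op_eq φ hp]
    exact add_nonneg (G0_nonneg h.nn hp) (G1_nonneg h.nn hp)

lemma Good.P0 (h : Good φ) {x y t : ℝ} (hx : -1 ≤ x) (hy : y ≤ 0) (h1 : x ≤ t) (h2 : t ≤ y)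
    (ht : t < 0) (hpos : 0 < φ (t, 0)) : 0 < B2op φ (x, y) := by
  have hp : (x, y) ∈ T2set := ⟨hx, h1.trans h2, hy⟩
  have ht2 : (t, (0 : ℝ)) ∈ T2set := ⟨hx.trans h1, ht.le, le_rfl⟩
  rw [B2op_eq φ hp]
  refine add_pos_of_pos_of_nonneg (G0_pos h.cont h.nn hp h1 h2 ht ?_) (G1_nonneg h.nn hp)
  rwa [Function.comp, prj_eq ht2]

lemma Good.P1 (h : Good φ) {x y t₀ t : ℝ} (hx : -1 < x) (hy : y ≤ 0) (h0 : -1 ≤ t₀)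
    (h0' : t₀ ≤ x) (h1 : x ≤ t) (h2 : t ≤ y)
    (ht : t₀ < t) (hpos : 0 < φ (t₀, t)) : 0 < B2op φ (x, y) := by
  have hp : (x, y) ∈ T2set := ⟨hx.le, h1.trans h2, hy⟩
  have ht2 : (t₀, t) ∈ T2set := ⟨h0, ht.le, h2.trans hy⟩
  rw [B2op_eq φ hp]
  refine add_pos_of_nonneg_of_pos (G0_nonneg h.nn hp) (G1_pos h.cont h.nn hp hx h0 h0' h1 h2 ht ?_)
  rwa [Function.comp, prj_eq ht2]

lemma Good.start (h : Good φ) (hne : ∃ p ∈ T2set, φ p ≠ 0) :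
    ∃ a b : ℝ, -1 ≤ a ∧ a < b ∧ b ≤ 0 ∧ 0 < φ (a, b) := by
  obtain ⟨⟨a, b⟩, ⟨h1, h2, h3⟩, hf⟩ := hne
  simp only at h1 h2 h3
  have hpos : 0 < φ (a, b) := lt_of_le_of_ne (h.2 _ ⟨h1, h2, h3⟩) (Ne.symm hf)
  let γ : ℝ → ℝ := fun s => (φ ∘ prj) (a + s * (-1 - a), b + s * (0 - b))
  have hγ : Continuous γ := h.cont.comp (by fun_prop)
  have h0 : 0 < γ 0 := by
    simp only [γ, Function.comp, zero_mul, add_zero]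
    rwa [prj_eq ⟨h1, h2, h3⟩]
  have hev : ∀ᶠ s in nhds (0 : ℝ), 0 < γ s := hγ.continuousAt.eventually (lt_mem_nhds h0)
  obtain ⟨ε, hε, hb⟩ := Metric.eventually_nhds_iff.1 hev
  have hs0 : 0 < min (ε / 2) (1 / 2) := by positivity
  have hs1 : min (ε / 2) (1 / 2) ≤ 1 / 2 := min_le_right _ _
  have hs2 : min (ε / 2) (1 / 2) < ε := (min_le_left _ _).trans_lt (by linarith)
  generalize min (ε / 2) (1 / 2) = s at *
  have := hb (y := s) (by simpa [abs_of_pos hs0] using hs2)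
  have e1 : -1 ≤ a + s * (-1 - a) := by nlinarith
  have e2 : a + s * (-1 - a) < b + s * (0 - b) := by nlinarith
  have e3 : b + s * (0 - b) ≤ 0 := by nlinarith
  refine ⟨_, _, e1, e2, e3, ?_⟩
  simp only [γ, Function.comp] at this
  rwa [prj_eq ⟨e1, e2.le, e3⟩] at this

lemma Good.two (h : Good φ) (hne : ∃ p ∈ T2set, φ p ≠ 0) {t : ℝ} (ht : -1 ≤ t) (ht0 : t ≤ 0) :
    0 < B2op (B2op φ) (t, 0) := by
  obtain ⟨a, b, ha, hab, hb, hpos⟩ := h.start hne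
  obtain ⟨c, hac, hcb⟩ := exists_between hab
  have hc : 0 < B2op φ (c, 0) :=
    h.P1 (by linarith) le_rfl ha hac.le hcb.le hb hab hpos
  rcases le_or_gt t c with htc | htc
  · exact h.step.P0 ht le_rfl htc (by linarith) (by linarith) hc
  · exact h.step.P1 (by linarith) le_rfl (by linarith) htc.le ht0 le_rfl (by linarith) hc

lemma Good.three (h : Good φ) (hp : ∀ t : ℝ, -1 ≤ t → t ≤ 0 → 0 < φ (t, 0)) :
    ∀ p ∈ T2set, 0 < B2op φ p := by
  rintro ⟨x, y⟩ ⟨h1, h2, h3⟩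
  simp only at h1 h2 h3
  rcases lt_or_eq_of_le (h2.trans h3) with hx | hx
  · exact h.P0 h1 h3 le_rfl h2 hx (hp x h1 hx.le)
  · exact h.P1 (t₀ := -1) (t := 0) (by linarith) h3 le_rfl h1 hx.le (by linarith) (by norm_num)
      (hp _ le_rfl (by norm_num))

lemma Good.iter (h : Good φ) (k : ℕ) : Good (B2op^[k] φ) := by
  induction k with
  | zero => exact h
  | succ k ih => rw [Function.iterate_succ_apply']; exact ih.step

lemma Good.all (h : Good φ) (hne : ∃ p ∈ T2set, φ p ≠ 0) (k : ℕ) (hk : 3 ≤ k) :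
    ∀ p ∈ T2set, 0 < B2op^[k] φ p := by
  induction k, hk using Nat.le_induction with
  | base => exact h.step.step.three fun t h1 h2 => h.two hne h1 h2
  | succ k hk ih =>
    rw [Function.iterate_succ_apply']
    exact (h.iter k).three fun t h1 h2 => ih _ ⟨h1, h2, le_rfl⟩

lemma T2_compact : IsCompact T2set := by
  have : T2set = prj '' (Set.Icc (-1) 0 ×ˢ Set.Icc (-1) 0) := by
    ext p
    constructor
    · intro hp
      exact ⟨p, ⟨⟨hp.1, hp.2.1.trans hp.2.2⟩, ⟨hp.1.trans hp.2.1, hp.2.2⟩⟩, prj_eq hp⟩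
    · rintro ⟨q, _, rfl⟩
      exact prj_mem q
  rw [this]
  exact (isCompact_Icc.prod isCompact_Icc).image prj_cont

lemma Good.final (h : Good φ) (hne : ∃ p ∈ T2set, φ p ≠ 0) (k : ℕ) (hk : 3 ≤ k) :
    ∃ C₁ C₂ : ℝ, 0 < C₁ ∧ C₁ ≤ C₂ ∧ ∀ p ∈ T2set, C₁ ≤ B2op^[k] φ p ∧ B2op^[k] φ p ≤ C₂ := by
  have hN : T2set.Nonempty := ⟨_, prj_mem 0⟩
  obtain ⟨q, hq, hm⟩ := T2_compact.exists_isMinOn hN (h.iter k).1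
  obtain ⟨r, hr, hM⟩ := T2_compact.exists_isMaxOn hN (h.iter k).1
  exact ⟨_, _, h.all hne k hk q hq, hm hr, fun p hp => ⟨hm hp, hM hp⟩⟩
end

theorem statement17 (φ : ℝ × ℝ → ℝ) (hcont : ContinuousOn φ T2set)
    (hpos : ∀ p ∈ T2set, 0 ≤ φ p) (hne : ∃ p ∈ T2set, φ p ≠ 0) :
    (∀ k : ℕ, 3 ≤ k → ∃ b : ℝ, 0 < b ∧ ∀ p ∈ T2set, b ≤ B2op^[k] φ p) ∧
    (∀ k : ℕ, 3 ≤ k → ∃ C₁ C₂ : ℝ, 0 < C₁ ∧ C₁ ≤ C₂ ∧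
      ∀ p ∈ T2set, C₁ ≤ B2op^[k] φ p ∧ B2op^[k] φ p ≤ C₂) := by
  have h : Good φ := ⟨hcont, hpos⟩
  refine ⟨fun k hk => ?_, h.final hne⟩
  obtain ⟨C₁, _, h1, _, h2⟩ := h.final hne k hk
  exact ⟨C₁, h1, fun p hp => (h2 p hp).1⟩
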